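/- Let a ∈ ℝ. Then the system (E0)–(Ek) holds on U: (E0) −a²g + f_0'g + a·f_1·g − f_0·g' + 2f_0 = 0; (E1) a(1 − 2g') + f_1'g + 2a·f_2·g + f_1 = 0; (E2) −g'' + f_2'g + 3a·f_3·g + f_2·g' = 0; (Ek) f_k'g + (k+1)a·f_{k+1}·g + (k−1)f_k·g' + (2−k)f_k = 0 for 3 ≤ k ≤ n−1, if and only if there exist real constants b_0, …, b_{n−1} such that, with b_n, A_k, B_k as defined in the context, for all u ∈ U: f_k(u) = (b_k + B_k(u))·((n−1)/(n−2))^{k−1}·|F(u)|^{(k−n)/(n−2)}·(F'(u))^{k−1} for each 0 ≤ k ≤ n with k ≠ 2, and f_2(u) = (b_2 + B_2(u))·((n−1)/(n−2))·(F'(u)/F(u)) + F'(u)/F(u) − F''(u)/F'(u). -/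

import Mathlib

/-- The function `g = ((n−2)F)/((n−1)F')`. -/
noncomputable def gFun (n : ℕ) (F : ℝ → ℝ) (u : ℝ) : ℝ :=
  (((n : ℝ) - 2) * F u) / (((n : ℝ) - 1) * deriv F u)

/-- The system (E0)-(Ek) of equations on `U`. -/
def Esys (n : ℕ) (f : ℕ → ℝ → ℝ) (a : ℝ) (U : Set ℝ) (g : ℝ → ℝ) : Prop :=
  (∀ u ∈ U, -a ^ 2 * g u + deriv (f 0) u * g u + a * f 1 u * g u
      - f 0 u * deriv g u + 2 * f 0 u = 0) ∧
  (∀ u ∈ U, a * (1 - 2 * deriv g u) + deriv (f 1) u * g u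
      + 2 * a * f 2 u * g u + f 1 u = 0) ∧
  (∀ u ∈ U, -(deriv (deriv g) u) + deriv (f 2) u * g u
      + 3 * a * f 3 u * g u + f 2 u * deriv g u = 0) ∧
  (∀ k : ℕ, 3 ≤ k → k ≤ n - 1 → ∀ u ∈ U,
      deriv (f k) u * g u + ((k : ℝ) + 1) * a * f (k + 1) u * g u
        + ((k : ℝ) - 1) * f k u * deriv g u + (2 - (k : ℝ)) * f k u = 0)

/-- The auxiliary functions `A_k`; note that `A_n = 0` (empty sum). -/
noncomputable def Afun (n : ℕ) (ν a : ℝ) (b : ℕ → ℝ) (F : ℝ → ℝ) (k : ℕ) (u : ℝ) : ℝ :=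
  ∑ i ∈ Finset.Icc 1 (n - k),
    (-ν) ^ i * ((k + i).choose i : ℝ) * a ^ i * b (k + i)
      * |F u| ^ (((i : ℝ) * ((n : ℝ) - 1)) / ((n : ℝ) - 2))

/-- The auxiliary functions `B_k`:  `B_k = A_k` for `k ≥ 3`, with modified `B_2, B_1, B_0`. -/
noncomputable def Bfun (n : ℕ) (ν a : ℝ) (b : ℕ → ℝ) (F : ℝ → ℝ) : ℕ → ℝ → ℝ
  | 0, u => Afun n ν a b F 0 u
      + a ^ 2 * (1 + b 2 * (1 - ν)) * ν * |F u| ^ ((2 * ((n : ℝ) - 1)) / ((n : ℝ) - 2))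
  | 1, u => Afun n ν a b F 1 u
      - a * |F u| ^ (((n : ℝ) - 1) / ((n : ℝ) - 2)) * (2 * b 2 * (1 - ν) + 1)
  | 2, u => ν * Afun n ν a b F 2 u
  | k, u => Afun n ν a b F k u

/-- The coefficients `f k`, rescaled so that the system becomes triangular with respect to `t`. -/
noncomputable def normCoeff (ν : ℝ) (f : ℕ → ℝ → ℝ) (g t : ℝ → ℝ) : ℕ → ℝ → ℝ
  | 2, u => f 2 u * g u - deriv g u
  | k, u => ν ^ ((k : ℤ) - 1) * f k u * g u ^ ((k : ℤ) - 1) * t u ^ (2 - (k : ℤ))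

/-- The derivative of the `k`-th rescaled coefficient with respect to `t`, at `t = τ`, when the
next rescaled coefficient takes the value `x`. -/
noncomputable def coeffSlope (ν a : ℝ) : ℕ → ℝ → ℝ → ℝ
  | 0, τ, x => ν * (a ^ 2 * τ - a * x)
  | 1, _, x => -a * (1 + 2 * x)
  | 2, _, x => -3 * a * x
  | k, _, x => -ν * ((k : ℝ) + 1) * a * x

lemma normCoeff_of_ne_two (ν : ℝ) (f : ℕ → ℝ → ℝ) (g t : ℝ → ℝ) {k : ℕ} (hk : k ≠ 2) :
    normCoeff ν f g t k =
      fun u => ν ^ ((k : ℤ) - 1) * f k u * g u ^ ((k : ℤ) - 1) * t u ^ (2 - (k : ℤ)) := by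
  match k, hk with
  | 0, _ => rfl
  | 1, _ => rfl
  | k + 3, _ => rfl

lemma coeffSlope_of_three_le (ν a τ x : ℝ) {k : ℕ} (hk : 3 ≤ k) :
    coeffSlope ν a k τ x = -ν * ((k : ℝ) + 1) * a * x := by
  match k, hk with
  | k + 3, _ => rfl

lemma hasDerivAt_normCoeff_of_ne_two {ν : ℝ} {f : ℕ → ℝ → ℝ} {g t : ℝ → ℝ} {k : ℕ} {u : ℝ}
    (hk : k ≠ 2) (hf : DifferentiableAt ℝ (f k) u) (hg : DifferentiableAt ℝ g u)
    (hg0 : g u ≠ 0) (ht0 : t u ≠ 0) (ht : HasDerivAt t (t u / g u) u) :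
    HasDerivAt (normCoeff ν f g t k)
      (ν ^ ((k : ℤ) - 1) * g u ^ ((k : ℤ) - 2) * t u ^ (2 - (k : ℤ)) *
        (deriv (f k) u * g u + ((k : ℝ) - 1) * f k u * deriv g u + (2 - (k : ℝ)) * f k u)) u := by
  rw [normCoeff_of_ne_two ν f g t hk]
  have h1 := (hasDerivAt_zpow ((k : ℤ) - 1) (g u) (Or.inl hg0)).comp u hg.hasDerivAt
  have h2 := (hasDerivAt_zpow (2 - (k : ℤ)) (t u) (Or.inl ht0)).comp u ht
  refine (((hf.hasDerivAt.const_mul (ν ^ ((k : ℤ) - 1))).mul h1).mul h2).congr_deriv ?_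
  have e1 : g u ^ ((k : ℤ) - 1) = g u ^ ((k : ℤ) - 2) * g u := by
    rw [← zpow_add_one₀ hg0]; congr 1; ring
  have e2 : t u ^ (2 - (k : ℤ)) = t u ^ (2 - (k : ℤ) - 1) * t u := by
    rw [← zpow_add_one₀ ht0]; congr 1; ring
  have e3 : (k : ℤ) - 1 - 1 = k - 2 := by ring
  simp only [Function.comp_apply, Pi.mul_apply]
  rw [e3, e1, e2]
  push_cast
  field_simp

lemma hasDerivAt_normCoeff_iff {ν a E x τ' : ℝ} {f : ℕ → ℝ → ℝ} {g t : ℝ → ℝ} {k : ℕ} {u : ℝ}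
    (hk : k ≠ 2) (hν : ν ≠ 0) (hf : DifferentiableAt ℝ (f k) u) (hg : DifferentiableAt ℝ g u)
    (hg0 : g u ≠ 0) (ht0 : t u ≠ 0) (ht : HasDerivAt t (t u / g u) u)
    (hx : ν ^ ((k : ℤ) - 1) * g u ^ ((k : ℤ) - 2) * t u ^ (2 - (k : ℤ)) * E =
      -(coeffSlope ν a k τ' x * (t u / g u))) :
    deriv (f k) u * g u + ((k : ℝ) - 1) * f k u * deriv g u + (2 - (k : ℝ)) * f k u + E = 0 ↔
      HasDerivAt (normCoeff ν f g t k) (coeffSlope ν a k τ' x * (t u / g u)) u := by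
  have h := hasDerivAt_normCoeff_of_ne_two (ν := ν) hk hf hg hg0 ht0 ht
  have hM : ν ^ ((k : ℤ) - 1) * g u ^ ((k : ℤ) - 2) * t u ^ (2 - (k : ℤ)) ≠ 0 :=
    mul_ne_zero (mul_ne_zero (zpow_ne_zero _ hν) (zpow_ne_zero _ hg0)) (zpow_ne_zero _ ht0)
  constructor
  · intro h0
    convert h using 1
    linear_combination hx - (ν ^ ((k : ℤ) - 1) * g u ^ ((k : ℤ) - 2) * t u ^ (2 - (k : ℤ))) * h0
  · intro h'
    have := h.unique h'
    apply mul_left_cancel₀ hM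
    linear_combination this + hx

lemma esys_iff_hasDerivAt_normCoeff {n : ℕ} (hn : 4 ≤ n) {f : ℕ → ℝ → ℝ} {a ν : ℝ} {U : Set ℝ}
    {g t : ℝ → ℝ} (hf : ∀ k ≤ n, ∀ u ∈ U, DifferentiableAt ℝ (f k) u)
    (hg : ∀ u ∈ U, DifferentiableAt ℝ g u) (hg' : ∀ u ∈ U, DifferentiableAt ℝ (deriv g) u)
    (hg0 : ∀ u ∈ U, g u ≠ 0) (ht0 : ∀ u ∈ U, t u ≠ 0)
    (ht : ∀ u ∈ U, HasDerivAt t (t u / g u) u) (hν : ν = 1 ∨ ν = -1) :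
    Esys n f a U g ↔ ∀ k < n, ∀ u ∈ U, HasDerivAt (normCoeff ν f g t k)
      (coeffSlope ν a k (t u) (normCoeff ν f g t (k + 1) u) * (t u / g u)) u := by
  have hν0 : ν ≠ 0 := by rcases hν with rfl | rfl <;> norm_num
  have hν2 : ν * ν = 1 := by rcases hν with rfl | rfl <;> norm_num
  have key0 : ∀ u ∈ U, (-a ^ 2 * g u + deriv (f 0) u * g u + a * f 1 u * g u
      - f 0 u * deriv g u + 2 * f 0 u = 0 ↔ HasDerivAt (normCoeff ν f g t 0)
      (coeffSlope ν a 0 (t u) (normCoeff ν f g t (0 + 1) u) * (t u / g u)) u) := by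
    intro u hu
    have hgu := hg0 u hu
    rw [← hasDerivAt_normCoeff_iff (E := -a ^ 2 * g u + a * f 1 u * g u) (by norm_num) hν0
      (hf 0 (by omega) u hu) (hg u hu) hgu (ht0 u hu) (ht u hu)]
    · push_cast
      constructor <;> intro h <;> linear_combination h
    · simp only [coeffSlope, normCoeff]
      norm_num
      rw [inv_eq_of_mul_eq_one_left hν2]
      field_simp
      ring
  have key1 : ∀ u ∈ U, (a * (1 - 2 * deriv g u) + deriv (f 1) u * g u
      + 2 * a * f 2 u * g u + f 1 u = 0 ↔ HasDerivAt (normCoeff ν f g t 1)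
      (coeffSlope ν a 1 (t u) (normCoeff ν f g t (1 + 1) u) * (t u / g u)) u) := by
    intro u hu
    have hgu := hg0 u hu
    rw [← hasDerivAt_normCoeff_iff (E := a * (1 - 2 * deriv g u) + 2 * a * f 2 u * g u)
      (by norm_num) hν0 (hf 1 (by omega) u hu) (hg u hu) hgu (ht0 u hu) (ht u hu)]
    · push_cast
      constructor <;> intro h <;> linear_combination h
    · simp only [coeffSlope, normCoeff]
      norm_num
      field_simp
      ring
  have key2 : ∀ u ∈ U, (-(deriv (deriv g) u) + deriv (f 2) u * g u
      + 3 * a * f 3 u * g u + f 2 u * deriv g u = 0 ↔ HasDerivAt (normCoeff ν f g t 2)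
      (coeffSlope ν a 2 (t u) (normCoeff ν f g t (2 + 1) u) * (t u / g u)) u) := by
    intro u hu
    have hgu := hg0 u hu
    have htu := ht0 u hu
    have h : HasDerivAt (normCoeff ν f g t 2)
        (deriv (f 2) u * g u + f 2 u * deriv g u - deriv (deriv g) u) u :=
      ((hf 2 (by omega) u hu).hasDerivAt.mul (hg u hu).hasDerivAt).sub (hg' u hu).hasDerivAt
    have e : coeffSlope ν a 2 (t u) (normCoeff ν f g t (2 + 1) u) * (t u / g u)
        = -(3 * a * f 3 u * g u) := by
      simp only [coeffSlope, normCoeff]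
      norm_num
      rw [show ν ^ 2 = 1 by rw [sq, hν2]]
      field_simp
    rw [e]
    constructor
    · intro h0
      convert h using 1
      linear_combination -h0
    · intro h'
      linear_combination h.unique h'
  have key3 : ∀ k : ℕ, 3 ≤ k → k < n → ∀ u ∈ U,
      (deriv (f k) u * g u + ((k : ℝ) + 1) * a * f (k + 1) u * g u
        + ((k : ℝ) - 1) * f k u * deriv g u + (2 - (k : ℝ)) * f k u = 0 ↔
      HasDerivAt (normCoeff ν f g t k)
      (coeffSlope ν a k (t u) (normCoeff ν f g t (k + 1) u) * (t u / g u)) u) := by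
    intro k hk hkn u hu
    have hgu := hg0 u hu
    have htu := ht0 u hu
    rw [← hasDerivAt_normCoeff_iff (E := ((k : ℝ) + 1) * a * f (k + 1) u * g u)
      (by omega) hν0 (hf k (by omega) u hu) (hg u hu) hgu htu (ht u hu)]
    · constructor <;> intro h <;> linear_combination h
    · rw [coeffSlope_of_three_le _ _ _ _ hk, normCoeff_of_ne_two _ _ _ _ (by omega)]
      push_cast
      have e1 : g u ^ ((k : ℤ) + 1 - 1) = g u ^ ((k : ℤ) - 2) * g u * g u := by
        rw [← zpow_add_one₀ hgu, ← zpow_add_one₀ hgu]; congr 1; ring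
      have e2 : t u ^ (2 - (k : ℤ)) = t u ^ (2 - ((k : ℤ) + 1)) * t u := by
        rw [← zpow_add_one₀ htu]; congr 1; ring
      have e3 : ν ^ ((k : ℤ) + 1 - 1) = ν ^ ((k : ℤ) - 1) * ν := by
        rw [← zpow_add_one₀ hν0]; congr 1; ring
      rw [e1, e2, e3]
      field_simp
      linear_combination -(a * f (k + 1) u) * hν2
  constructor
  · rintro ⟨h0, h1, h2, h3⟩ k hk u hu
    match k, hk with
    | 0, _ => exact (key0 u hu).1 (h0 u hu)
    | 1, _ => exact (key1 u hu).1 (h1 u hu)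
    | 2, _ => exact (key2 u hu).1 (h2 u hu)
    | k + 3, hk =>
      exact (key3 (k + 3) (by omega) hk u hu).1 (h3 (k + 3) (by omega) (by omega) u hu)
  · intro h
    exact ⟨fun u hu => (key0 u hu).2 (h 0 (by omega) u hu),
      fun u hu => (key1 u hu).2 (h 1 (by omega) u hu),
      fun u hu => (key2 u hu).2 (h 2 (by omega) u hu),
      fun k hk hkn u hu => (key3 k hk (by omega) u hu).2 (h k (by omega) u hu)⟩

lemma abs_rpow_natCast_mul_div (n : ℕ) (x : ℝ) (i : ℕ) :
    |x| ^ (((i : ℝ) * ((n : ℝ) - 1)) / ((n : ℝ) - 2)) =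
      (|x| ^ (((n : ℝ) - 1) / ((n : ℝ) - 2))) ^ i := by
  rw [← Real.rpow_mul_natCast (abs_nonneg x)]
  congr 1
  ring

lemma Afun_self (n : ℕ) (ν a : ℝ) (b : ℕ → ℝ) (F : ℝ → ℝ) (u : ℝ) :
    Afun n ν a b F n u = 0 := by
  simp [Afun]

lemma Bfun_of_three_le (n : ℕ) (ν a : ℝ) (b : ℕ → ℝ) (F : ℝ → ℝ) {k : ℕ} (hk : 3 ≤ k) :
    Bfun n ν a b F k = Afun n ν a b F k := by
  match k, hk with
  | k + 3, _ => rfl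

lemma Afun_congr {n k : ℕ} (ν a : ℝ) {b b' : ℕ → ℝ} (F : ℝ → ℝ) (h : ∀ j, k < j → b j = b' j) :
    Afun n ν a b F k = Afun n ν a b' F k := by
  funext u
  refine Finset.sum_congr rfl fun i hi => ?_
  rw [h (k + i) (by have := (Finset.mem_Icc.1 hi).1; omega)]

lemma Bfun_congr {n k : ℕ} (ν a : ℝ) {b b' : ℕ → ℝ} (F : ℝ → ℝ) (h : ∀ j, k < j → b j = b' j) :
    Bfun n ν a b F k = Bfun n ν a b' F k := by
  funext u
  have hA := Afun_congr (n := n) ν a F h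
  match k, h, hA with
  | 0, h, hA => simp only [Bfun, hA, h 2 (by norm_num)]
  | 1, h, hA => simp only [Bfun, hA, h 2 (by norm_num)]
  | 2, h, hA => simp only [Bfun, hA]
  | k + 3, h, hA => simp only [Bfun, hA]

lemma hasDerivAt_Afun {n k : ℕ} (hk : k < n) {ν a : ℝ} {b : ℕ → ℝ} {F : ℝ → ℝ} {u t' : ℝ}
    (ht : HasDerivAt (fun v => |F v| ^ (((n : ℝ) - 1) / ((n : ℝ) - 2))) t' u) :
    HasDerivAt (Afun n ν a b F k)
      (-ν * ((k : ℝ) + 1) * a * (b (k + 1) + Afun n ν a b F (k + 1) u) * t') u := by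
  obtain ⟨m, rfl⟩ := Nat.exists_eq_add_of_lt hk
  set t : ℝ → ℝ := fun v => |F v| ^ ((((k + m + 1 : ℕ) : ℝ) - 1) / (((k + m + 1 : ℕ) : ℝ) - 2))
  have e1 : Afun (k + m + 1) ν a b F k = fun v => ∑ j ∈ Finset.range (m + 1),
      (-ν) ^ (j + 1) * ((k + (j + 1)).choose (j + 1) : ℝ) * a ^ (j + 1) * b (k + (j + 1))
        * t v ^ (j + 1) := by
    funext v
    simp only [Afun, abs_rpow_natCast_mul_div, show k + m + 1 - k = m + 1 by omega]
    rw [← Finset.Ico_succ_right_eq_Icc, Finset.sum_Ico_eq_sum_range]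
    exact Finset.sum_congr (by simp) fun j _ => by rw [add_comm 1 j]
  have e2 : b (k + 1) + Afun (k + m + 1) ν a b F (k + 1) u = ∑ j ∈ Finset.range (m + 1),
      (-ν) ^ j * ((k + 1 + j).choose j : ℝ) * a ^ j * b (k + 1 + j) * t u ^ j := by
    simp only [Afun, abs_rpow_natCast_mul_div, show k + m + 1 - (k + 1) = m by omega]
    rw [← Finset.Ico_succ_right_eq_Icc, Finset.sum_Ico_eq_sum_range, Finset.sum_range_succ']
    simp only [pow_zero, Nat.choose_zero_right, Nat.cast_one, mul_one, one_mul, add_zero]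
    rw [add_comm]
    congr 1
    exact Finset.sum_congr (by simp) fun j _ => by rw [add_comm 1 j]
  rw [e1, e2]
  refine (HasDerivAt.fun_sum fun j _ => (ht.pow (j + 1)).const_mul _).congr_deriv ?_
  rw [Finset.mul_sum, Finset.sum_mul]
  refine Finset.sum_congr rfl fun j _ => ?_
  have hc : ((k + 1 + j).choose (j + 1) : ℝ) * (j + 1) = ((k + 1 + j).choose j : ℝ) * (k + 1) := by
    have := Nat.choose_succ_right_eq (k + 1 + j) j
    rw [show k + 1 + j - j = k + 1 by omega] at this
    exact_mod_cast this
  rw [show k + (j + 1) = k + 1 + j by ring]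
  push_cast
  linear_combination ((-ν) ^ (j + 1) * a ^ (j + 1) * b (k + 1 + j) * t u ^ j * t') * hc

lemma hasDerivAt_Bfun {n k : ℕ} (hk : k < n) {ν a : ℝ} (hν : ν = 1 ∨ ν = -1)
    {b : ℕ → ℝ} {F : ℝ → ℝ} {u t' : ℝ}
    (ht : HasDerivAt (fun v => |F v| ^ (((n : ℝ) - 1) / ((n : ℝ) - 2))) t' u) :
    HasDerivAt (Bfun n ν a b F k)
      (coeffSlope ν a k (|F u| ^ (((n : ℝ) - 1) / ((n : ℝ) - 2)))
        (b (k + 1) + Bfun n ν a b F (k + 1) u) * t') u := by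
  have hν2 : ν ^ 2 = 1 := by rcases hν with rfl | rfl <;> norm_num
  have hA := hasDerivAt_Afun (ν := ν) (a := a) (b := b) hk ht
  match k, hk, hA with
  | 0, _, hA =>
    have h2 : Bfun n ν a b F 0 = fun v => Afun n ν a b F 0 v
        + a ^ 2 * (1 + b 2 * (1 - ν)) * ν * (|F v| ^ (((n : ℝ) - 1) / ((n : ℝ) - 2))) ^ 2 := by
      funext v
      rw [← abs_rpow_natCast_mul_div]
      simp [Bfun]
    rw [h2]
    refine (hA.add ((ht.pow 2).const_mul _)).congr_deriv ?_
    simp only [coeffSlope, Bfun]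
    push_cast
    ring
  | 1, _, hA =>
    refine (hA.sub ((ht.const_mul a).mul_const (2 * b 2 * (1 - ν) + 1))).congr_deriv ?_
    simp only [coeffSlope, Bfun]
    push_cast
    ring
  | 2, _, hA =>
    refine (hA.const_mul ν).congr_deriv ?_
    simp only [coeffSlope, Bfun]
    push_cast
    linear_combination (-(3 * a * (b (2 + 1) + Afun n ν a b F (2 + 1) u) * t')) * hν2
  | k + 3, _, hA =>
    rw [Bfun_of_three_le _ _ _ _ _ (by omega), Bfun_of_three_le _ _ _ _ _ (by omega),
      coeffSlope_of_three_le _ _ _ _ (by omega)]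
    exact hA

lemma exists_eq_const_add_of_hasDerivAt {U : Set ℝ} (hU : IsOpen U) (hUc : U.OrdConnected)
    {p q d : ℝ → ℝ} (hp : ∀ u ∈ U, HasDerivAt p (d u) u) (hq : ∀ u ∈ U, HasDerivAt q (d u) u) :
    ∃ c, ∀ u ∈ U, p u = c + q u := by
  have hs : ∀ u ∈ U, HasDerivAt (fun v => p v - q v) 0 u := fun u hu => by
    simpa only [sub_self] using (hp u hu).fun_sub (hq u hu)
  obtain ⟨c, hc⟩ := hU.exists_is_const_of_deriv_eq_zero hUc.isPreconnected
    (fun u hu => (hs u hu).differentiableAt.differentiableWithinAt) (fun u hu => (hs u hu).deriv)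
  exact ⟨c, fun u hu => by linear_combination hc u hu⟩

lemma hasDerivAt_coeffSlope_iff_exists {n : ℕ} (hn : 4 ≤ n) {ν a β : ℝ} (hν : ν = 1 ∨ ν = -1)
    {U : Set ℝ} (hU : IsOpen U) (hUc : U.OrdConnected) {F t' : ℝ → ℝ} {H : ℕ → ℝ → ℝ}
    (ht : ∀ u ∈ U, HasDerivAt (fun v => |F v| ^ (((n : ℝ) - 1) / ((n : ℝ) - 2))) (t' u) u)
    (hH : ∀ u ∈ U, H n u = β) :
    (∀ k < n, ∀ u ∈ U, HasDerivAt (H k) (coeffSlope ν a k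
      (|F u| ^ (((n : ℝ) - 1) / ((n : ℝ) - 2))) (H (k + 1) u) * t' u) u) ↔
      ∃ b : ℕ → ℝ, b n = β ∧ ∀ k ≤ n, ∀ u ∈ U, H k u = b k + Bfun n ν a b F k u := by
  constructor
  · intro h
    have step : ∀ j ≤ n, ∃ b : ℕ → ℝ, b n = β ∧
        ∀ k ≤ n, n - j ≤ k → ∀ u ∈ U, H k u = b k + Bfun n ν a b F k u := by
      intro j
      induction j with
      | zero =>
        refine fun _ => ⟨fun _ => β, rfl, fun k hk hk' u hu => ?_⟩
        obtain rfl : k = n := by omega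
        rw [Bfun_of_three_le _ _ _ _ _ (by omega), Afun_self, hH u hu, add_zero]
      | succ j ih =>
        intro hj
        obtain ⟨b, hbn, hb⟩ := ih (by omega)
        obtain ⟨k₀, hk₀⟩ : ∃ k₀, k₀ = n - (j + 1) := ⟨_, rfl⟩
        obtain ⟨c, hc⟩ := exists_eq_const_add_of_hasDerivAt hU hUc (h k₀ (by omega))
          (q := Bfun n ν a b F k₀) (fun u hu => by
            rw [hb (k₀ + 1) (by omega) (by omega) u hu]
            exact hasDerivAt_Bfun (by omega) hν (ht u hu))
        have hB : ∀ k, k₀ ≤ k → Bfun n ν a (Function.update b k₀ c) F k = Bfun n ν a b F k :=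
          fun k hk => Bfun_congr ν a F fun i hi => Function.update_of_ne (by omega) _ _
        refine ⟨Function.update b k₀ c, ?_, fun k hk hk' u hu => ?_⟩
        · rw [Function.update_of_ne (by omega), hbn]
        · rw [hB k (by omega)]
          obtain rfl | hne := eq_or_ne k k₀
          · rw [Function.update_self, hc u hu]
          · rw [Function.update_of_ne hne, hb k hk (by omega) u hu]
    obtain ⟨b, hbn, hb⟩ := step n le_rfl
    exact ⟨b, hbn, fun k hk => hb k hk (by omega)⟩
  · rintro ⟨b, -, hb⟩ k hk u hu
    rw [hb (k + 1) hk u hu]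
    refine ((hasDerivAt_Bfun hk hν (ht u hu)).const_add (b k)).congr_of_eventuallyEq ?_
    filter_upwards [hU.mem_nhds hu] with v hv using hb k hk.le v hv

lemma eq_mul_zpow_iff {n k : ℕ} (hn : 4 ≤ n) {ν x d y X : ℝ}
    (hx : x ≠ 0) (hνx : |x| = ν * x) (hd : d ≠ 0) :
    ν ^ ((k : ℤ) - 1) * y * ((((n : ℝ) - 2) * x) / (((n : ℝ) - 1) * d)) ^ ((k : ℤ) - 1)
        * (|x| ^ (((n : ℝ) - 1) / ((n : ℝ) - 2))) ^ (2 - (k : ℤ)) = X ↔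
      y = X * (((n : ℝ) - 1) / ((n : ℝ) - 2)) ^ ((k : ℤ) - 1)
        * |x| ^ ((((k : ℝ) - (n : ℝ)) / ((n : ℝ) - 2))) * d ^ ((k : ℤ) - 1) := by
  have hn' : (4 : ℝ) ≤ n := by exact_mod_cast hn
  have h1 : (n : ℝ) - 1 ≠ 0 := by linarith
  have h2 : (n : ℝ) - 2 ≠ 0 := by linarith
  have hax : 0 < |x| := abs_pos.2 hx
  have e1 : ν ^ ((k : ℤ) - 1) * ((((n : ℝ) - 2) * x) / (((n : ℝ) - 1) * d)) ^ ((k : ℤ) - 1) =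
      |x| ^ ((k : ℝ) - 1) * ((((n : ℝ) - 1) / ((n : ℝ) - 2)) ^ ((k : ℤ) - 1)
        * d ^ ((k : ℤ) - 1))⁻¹ := by
    have : |x| ^ ((k : ℝ) - 1) = |x| ^ ((k : ℤ) - 1) := by
      rw [← Real.rpow_intCast]; push_cast; rfl
    rw [this, ← mul_zpow, ← mul_zpow, ← inv_zpow, ← mul_zpow, hνx]
    congr 1
    field_simp
  have e2 : (|x| ^ (((n : ℝ) - 1) / ((n : ℝ) - 2))) ^ (2 - (k : ℤ)) =
      |x| ^ (-((k : ℝ) - 1)) * (|x| ^ (((k : ℝ) - (n : ℝ)) / ((n : ℝ) - 2)))⁻¹ := by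
    rw [← Real.rpow_intCast, ← Real.rpow_mul hax.le, ← Real.rpow_neg hax.le,
      ← Real.rpow_add hax]
    congr 1
    push_cast
    field_simp
    ring
  have hc : (((n : ℝ) - 1) / ((n : ℝ) - 2)) ^ ((k : ℤ) - 1) ≠ 0 :=
    zpow_ne_zero _ (div_ne_zero h1 h2)
  have hd' : d ^ ((k : ℤ) - 1) ≠ 0 := zpow_ne_zero _ hd
  have hp : |x| ^ (((k : ℝ) - (n : ℝ)) / ((n : ℝ) - 2)) ≠ 0 := (Real.rpow_pos_of_pos hax _).ne'
  have hq : |x| ^ ((k : ℝ) - 1) ≠ 0 := (Real.rpow_pos_of_pos hax _).ne'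
  rw [mul_right_comm (ν ^ ((k : ℤ) - 1)), e1, e2, Real.rpow_neg hax.le]
  generalize |x| ^ (((k : ℝ) - (n : ℝ)) / ((n : ℝ) - 2)) = p at hp ⊢
  generalize |x| ^ ((k : ℝ) - 1) = q at hq ⊢
  generalize (((n : ℝ) - 1) / ((n : ℝ) - 2)) ^ ((k : ℤ) - 1) = c at hc ⊢
  generalize d ^ ((k : ℤ) - 1) = e at hd' ⊢
  constructor
  · rintro rfl
    field_simp
  · rintro rfl
    field_simp

lemma hasDerivAt_gFun {n : ℕ} (hn : 4 ≤ n) {F : ℝ → ℝ} {u : ℝ} (h₁ : DifferentiableAt ℝ F u)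
    (h₂ : DifferentiableAt ℝ (deriv F) u) (h0 : deriv F u ≠ 0) :
    HasDerivAt (gFun n F) (((n : ℝ) - 2) / ((n : ℝ) - 1)
      * (1 - F u * deriv (deriv F) u / deriv F u ^ 2)) u := by
  have hn' : (4 : ℝ) ≤ n := by exact_mod_cast hn
  have h1 : (n : ℝ) - 1 ≠ 0 := by linarith
  refine ((h₁.hasDerivAt.const_mul ((n : ℝ) - 2)).div (h₂.hasDerivAt.const_mul ((n : ℝ) - 1))
    (mul_ne_zero h1 h0)).congr_deriv ?_
  field_simp

lemma hasDerivAt_abs_rpow_div {n : ℕ} (hn : 4 ≤ n) {U : Set ℝ} (hU : IsOpen U) {F : ℝ → ℝ} {ν : ℝ}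
    (hνF : ∀ u ∈ U, |F u| = ν * F u) {u : ℝ} (hu : u ∈ U) (hF : DifferentiableAt ℝ F u)
    (hF0 : F u ≠ 0) (h0 : deriv F u ≠ 0) :
    HasDerivAt (fun v => |F v| ^ (((n : ℝ) - 1) / ((n : ℝ) - 2)))
      (|F u| ^ (((n : ℝ) - 1) / ((n : ℝ) - 2)) / gFun n F u) u := by
  have hn' : (4 : ℝ) ≤ n := by exact_mod_cast hn
  have h1 : (n : ℝ) - 1 ≠ 0 := by linarith
  have h2 : (n : ℝ) - 2 ≠ 0 := by linarith
  have hax : 0 < |F u| := abs_pos.2 hF0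
  have habs : HasDerivAt (fun v => |F v|) (ν * deriv F u) u := by
    refine (hF.hasDerivAt.const_mul ν).congr_of_eventuallyEq ?_
    filter_upwards [hU.mem_nhds hu] with v hv using hνF v hv
  refine (habs.rpow_const (Or.inl hax.ne')).congr_deriv ?_
  have hν0 : ν ≠ 0 := by
    rintro rfl
    simp [hνF u hu] at hax
  rw [Real.rpow_sub_one hax.ne', gFun]
  nth_rewrite 2 [hνF u hu]
  field_simp

theorem stmt9 (n : ℕ) (hn : 4 ≤ n)
    (U : Set ℝ) (hU : IsOpen U) (hUc : U.OrdConnected)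
    (f : ℕ → ℝ → ℝ) (hf : ∀ k ≤ n, ∀ u ∈ U, DifferentiableAt ℝ (f k) u)
    (F : ℝ → ℝ)
    (hF₁ : ∀ u ∈ U, DifferentiableAt ℝ F u)
    (hF₂ : ∀ u ∈ U, DifferentiableAt ℝ (deriv F) u)
    (hF₃ : ∀ u ∈ U, DifferentiableAt ℝ (deriv (deriv F)) u)
    (hfn : ∀ u ∈ U, f n u ≠ 0)
    (hFne : ∀ u ∈ U, F u ≠ 0)
    (hF' : ∀ u ∈ U, deriv F u = |f n u| ^ ((1 : ℝ) / ((n : ℝ) - 1)))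
    (ε ν : ℝ) (hε : ε = 1 ∨ ε = -1) (hν : ν = 1 ∨ ν = -1)
    (hεf : ∀ u ∈ U, |f n u| = ε * f n u) (hνF : ∀ u ∈ U, |F u| = ν * F u)
    (a : ℝ) :
    Esys n f a U (gFun n F) ↔
      ∃ b : ℕ → ℝ,
        b n = ε * ((((n : ℝ) - 1) / ((n : ℝ) - 2)) ^ ((1 : ℤ) - (n : ℤ))) ∧
        (∀ k ≤ n, k ≠ 2 → ∀ u ∈ U,
          f k u = (b k + Bfun n ν a b F k u) * (((n : ℝ) - 1) / ((n : ℝ) - 2)) ^ ((k : ℤ) - 1)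
            * |F u| ^ ((((k : ℝ) - (n : ℝ)) / ((n : ℝ) - 2)))
            * (deriv F u) ^ ((k : ℤ) - 1)) ∧
        (∀ u ∈ U,
          f 2 u = (b 2 + Bfun n ν a b F 2 u) * (((n : ℝ) - 1) / ((n : ℝ) - 2))
              * (deriv F u / F u)
            + deriv F u / F u - deriv (deriv F) u / deriv F u) := by
  have hn' : (4 : ℝ) ≤ n := by exact_mod_cast hn
  have h1 : (n : ℝ) - 1 ≠ 0 := by linarith
  have h2 : (n : ℝ) - 2 ≠ 0 := by linarith
  have hF0 : ∀ u ∈ U, deriv F u ≠ 0 := fun u hu => by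
    rw [hF' u hu]
    exact (Real.rpow_pos_of_pos (abs_pos.2 (hfn u hu)) _).ne'
  have hg1 : ∀ u ∈ U, HasDerivAt (gFun n F) (((n : ℝ) - 2) / ((n : ℝ) - 1)
      * (1 - F u * deriv (deriv F) u / deriv F u ^ 2)) u :=
    fun u hu => hasDerivAt_gFun hn (hF₁ u hu) (hF₂ u hu) (hF0 u hu)
  have hg2 : ∀ u ∈ U, DifferentiableAt ℝ (deriv (gFun n F)) u := fun u hu => by
    have hd : DifferentiableAt ℝ (fun v => ((n : ℝ) - 2) / ((n : ℝ) - 1)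
        * (1 - F v * deriv (deriv F) v / deriv F v ^ 2)) u :=
      ((((hF₁ u hu).mul (hF₃ u hu)).div ((hF₂ u hu).pow 2)
        (pow_ne_zero 2 (hF0 u hu))).const_sub 1).const_mul _
    refine hd.congr_of_eventuallyEq ?_
    filter_upwards [hU.mem_nhds hu] with v hv using (hg1 v hv).deriv
  have hg0 : ∀ u ∈ U, gFun n F u ≠ 0 := fun u hu =>
    div_ne_zero (mul_ne_zero h2 (hFne u hu)) (mul_ne_zero h1 (hF0 u hu))
  have ht := fun u hu => hasDerivAt_abs_rpow_div hn hU hνF hu (hF₁ u hu) (hFne u hu) (hF0 u hu)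
  have hform : ∀ k ≠ 2, ∀ u ∈ U, ∀ X : ℝ,
      (normCoeff ν f (gFun n F) (fun v => |F v| ^ (((n : ℝ) - 1) / ((n : ℝ) - 2))) k u = X ↔
        f k u = X * (((n : ℝ) - 1) / ((n : ℝ) - 2)) ^ ((k : ℤ) - 1)
            * |F u| ^ ((((k : ℝ) - (n : ℝ)) / ((n : ℝ) - 2))) * (deriv F u) ^ ((k : ℤ) - 1)) := by
    intro k hk u hu X
    rw [normCoeff_of_ne_two _ _ _ _ hk]
    exact eq_mul_zpow_iff hn (hFne u hu) (hνF u hu) (hF0 u hu)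
  have hform2 : ∀ u ∈ U, ∀ X : ℝ,
      (normCoeff ν f (gFun n F) (fun v => |F v| ^ (((n : ℝ) - 1) / ((n : ℝ) - 2))) 2 u = X ↔
        f 2 u = X * (((n : ℝ) - 1) / ((n : ℝ) - 2)) * (deriv F u / F u)
            + deriv F u / F u - deriv (deriv F) u / deriv F u) := by
    intro u hu X
    have hFu := hFne u hu
    have hdu := hF0 u hu
    simp only [normCoeff, (hg1 u hu).deriv]
    rw [gFun]
    constructor
    · rintro rfl
      field_simp
      ring
    · intro h
      rw [h]
      field_simp
      ring
  have hHn : ∀ u ∈ U,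
      normCoeff ν f (gFun n F) (fun v => |F v| ^ (((n : ℝ) - 1) / ((n : ℝ) - 2))) n u =
        ε * ((((n : ℝ) - 1) / ((n : ℝ) - 2)) ^ ((1 : ℤ) - (n : ℤ))) := by
    intro u hu
    have hp : deriv F u ^ ((n : ℤ) - 1) = |f n u| := by
      rw [hF' u hu, ← Real.rpow_intCast, ← Real.rpow_mul (abs_nonneg _)]
      push_cast
      rw [one_div_mul_cancel h1, Real.rpow_one]
    have hc : (((n : ℝ) - 1) / ((n : ℝ) - 2)) ^ ((1 : ℤ) - (n : ℤ))
        * (((n : ℝ) - 1) / ((n : ℝ) - 2)) ^ ((n : ℤ) - 1) = 1 := by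
      rw [← zpow_add₀ (div_ne_zero h1 h2)]
      simp
    rw [hform n (by omega) u hu, hp, hεf u hu, sub_self, zero_div, Real.rpow_zero,
      mul_assoc ε, hc]
    rcases hε with rfl | rfl <;> ring
  rw [esys_iff_hasDerivAt_normCoeff hn hf (fun u hu => (hg1 u hu).differentiableAt) hg2 hg0
    (fun u hu => (Real.rpow_pos_of_pos (abs_pos.2 (hFne u hu)) _).ne') ht hν,
    hasDerivAt_coeffSlope_iff_exists hn hν hU hUc ht hHn]
  refine exists_congr fun b => and_congr_right fun _ => ⟨fun h => ⟨fun k hk hk2 u hu =>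
    (hform k hk2 u hu _).1 (h k hk u hu), fun u hu =>
    (hform2 u hu _).1 (h 2 (by omega) u hu)⟩, fun h k hk u hu => ?_⟩
  obtain rfl | hk2 := eq_or_ne k 2
  · exact (hform2 u hu _).2 (h.2 u hu)
  · exact (hform k hk2 u hu _).2 (h.1 k hk hk2 u hu)
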